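/- In the setting described, the *-algebra 𝒳 is algebraically bounded: for every z ∈ 𝒳 there exists λ > 0 such that λ·1 + Re z ∈ Σ²(𝒳), λ·1 − Re z ∈ Σ²(𝒳), λ·1 + Im z ∈ Σ²(𝒳) and λ·1 − Im z ∈ Σ²(𝒳), where Re z := (z + z*)/2 and Im z := (i/2)(z* − z). -/

import Mathlib

open scoped BigOperators

/-- The extended family `X₀, X₁, …, X_d` where `X₀ = i·1`. -/
noncomputable def extX {B : Type*} [Ring B] [Algebra ℂ B] {d : ℕ} (X : Fin d → B) :
    Fin (d + 1) → B :=
  Fin.cases (Complex.I • (1 : B)) X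

/-- The elements `Y_{kl} := X_k X_l Y` for `k, l = 0, …, d`. -/
noncomputable def Ymat {B : Type*} [Ring B] [Algebra ℂ B] {d : ℕ} (X : Fin d → B) (Y : B)
    (k l : Fin (d + 1)) : B :=
  extX X k * extX X l * Y

/-- The *-algebra `𝒳`: the unital subalgebra of `B` generated by all elements
`X_k X_l Y` and `Y X_l X_k` with `k, l = 0, …, d`. -/
noncomputable def scriptX {B : Type*} [Ring B] [Algebra ℂ B] {d : ℕ} (X : Fin d → B) (Y : B) :
    Subalgebra ℂ B :=
  Algebra.adjoin ℂ
    {b : B | ∃ k l : Fin (d + 1), b = extX X k * extX X l * Y ∨ b = Y * (extX X l * extX X k)}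

/-- The two-sided ideal `𝒳₀` of `𝒳` generated by the elements `X_k Y` and `Y X_k`,
`k = 0, …, d`: its elements are the finite sums of products `x · g · z` with
`x, z ∈ 𝒳` and `g` one of the generators. -/
noncomputable def scriptX0 {B : Type*} [Ring B] [Algebra ℂ B] {d : ℕ} (X : Fin d → B) (Y : B) :
    AddSubgroup B :=
  AddSubgroup.closure
    {b : B | ∃ x ∈ scriptX X Y, ∃ z ∈ scriptX X Y, ∃ k : Fin (d + 1),
      b = x * (extX X k * Y) * z ∨ b = x * (Y * extX X k) * z}

/-- `Σ²(𝒳)`: finite sums of elements `x* x` with `x ∈ 𝒳`, viewed inside `B`. -/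
noncomputable def sumSqScriptX {B : Type*} [Ring B] [Algebra ℂ B] [StarRing B] {d : ℕ}
    (X : Fin d → B) (Y : B) : AddSubmonoid B :=
  AddSubmonoid.closure {b : B | ∃ x ∈ scriptX X Y, b = star x * x}

section BoundedElements

variable {B : Type*} [Ring B] [Algebra ℂ B] [StarRing B] [StarModule ℂ B]

/-- Finite sums of hermitian squares `x* x` with `x` in a *-subalgebra `S`. -/
def hermSquares (S : StarSubalgebra ℂ B) : AddSubmonoid B :=
  AddSubmonoid.closure {b : B | ∃ x ∈ S, b = star x * x}

/-- The elements `z ∈ S` such that `r·1 - z* z` is a sum of hermitian squares for some `r > 0`. -/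
def IsAlgBounded (S : StarSubalgebra ℂ B) (z : B) : Prop :=
  z ∈ S ∧ ∃ r : ℝ, 0 < r ∧ (r : ℂ) • (1 : B) - star z * z ∈ hermSquares S

variable {S : StarSubalgebra ℂ B}

lemma star_mul_self_mem_hermSquares {x : B} (hx : x ∈ S) : star x * x ∈ hermSquares S :=
  AddSubmonoid.subset_closure ⟨x, hx, rfl⟩

lemma conj_mem_hermSquares {a x : B} (ha : a ∈ hermSquares S) (hx : x ∈ S) :
    star x * a * x ∈ hermSquares S := by
  induction ha using AddSubmonoid.closure_induction with
  | mem a h =>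
    obtain ⟨y, hy, rfl⟩ := h
    have := star_mul_self_mem_hermSquares (S := S) (mul_mem hy hx)
    simpa [mul_assoc] using this
  | zero => simp
  | add a b _ _ iha ihb =>
    rw [mul_add, add_mul]
    exact add_mem iha ihb

lemma smul_mem_hermSquares {a : B} (ha : a ∈ hermSquares S) {r : ℝ} (hr : 0 ≤ r) :
    (r : ℂ) • a ∈ hermSquares S := by
  have h := conj_mem_hermSquares ha (S.smul_mem (one_mem S) (Real.sqrt r : ℂ))
  simpa [star_smul, smul_smul, Real.mul_self_sqrt hr] using h

lemma smul_one_mem_hermSquares {r : ℝ} (hr : 0 ≤ r) : (r : ℂ) • (1 : B) ∈ hermSquares S :=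
  smul_mem_hermSquares (by simpa using star_mul_self_mem_hermSquares (one_mem S)) hr

namespace IsAlgBounded

lemma smul {z : B} (hz : IsAlgBounded S z) (a : ℂ) : IsAlgBounded S (a • z) := by
  obtain ⟨hzS, r, hr, h⟩ := hz
  refine ⟨S.smul_mem hzS a, Complex.normSq a * r + 1, by positivity [Complex.normSq_nonneg a], ?_⟩
  convert add_mem (smul_mem_hermSquares h (Complex.normSq_nonneg a))
    (smul_one_mem_hermSquares (S := S) zero_le_one) using 1
  simp only [star_smul, smul_mul_assoc, mul_smul_comm, smul_smul, smul_sub,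
    Complex.normSq_eq_conj_mul_self]
  push_cast
  rw [Complex.normSq_eq_conj_mul_self]
  simp only [starRingEnd_apply, mul_comm a]
  module

lemma mul {z w : B} (hz : IsAlgBounded S z) (hw : IsAlgBounded S w) :
    IsAlgBounded S (z * w) := by
  obtain ⟨hzS, r, hr, h⟩ := hz
  obtain ⟨hwS, s, hs, h'⟩ := hw
  refine ⟨mul_mem hzS hwS, r * s, mul_pos hr hs, ?_⟩
  convert add_mem (conj_mem_hermSquares h hwS) (smul_mem_hermSquares h' hr.le) using 1
  simp only [star_mul, mul_sub, sub_mul, smul_mul_assoc, mul_smul_comm, smul_smul, smul_sub,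
    mul_one, mul_assoc, Complex.ofReal_mul]
  module

lemma add {z w : B} (hz : IsAlgBounded S z) (hw : IsAlgBounded S w) :
    IsAlgBounded S (z + w) := by
  obtain ⟨hzS, r, hr, h⟩ := hz
  obtain ⟨hwS, s, hs, h'⟩ := hw
  refine ⟨add_mem hzS hwS, 2 * (r + s), by positivity, ?_⟩
  convert add_mem (smul_mem_hermSquares (add_mem h h') zero_le_two)
    (star_mul_self_mem_hermSquares (sub_mem hzS hwS)) using 1
  simp only [star_add, star_sub, mul_sub, sub_mul, mul_add, add_mul]
  push_cast
  module

lemma algebraMap (a : ℂ) : IsAlgBounded S (algebraMap ℂ B a) := by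
  rw [Algebra.algebraMap_eq_smul_one]
  refine smul ⟨one_mem S, 1, one_pos, ?_⟩ a
  simp

lemma star {z : B} (hz : IsAlgBounded S z) : IsAlgBounded S (star z) := by
  obtain ⟨hzS, r, hr, h⟩ := hz
  refine ⟨star_mem hzS, r, hr, ?_⟩
  have hx : (r : ℂ) • (1 : B) - z * Star.star z ∈ S :=
    sub_mem (S.smul_mem (one_mem S) _) (mul_mem hzS (star_mem hzS))
  have key := smul_mem_hermSquares (add_mem (star_mul_self_mem_hermSquares hx)
    (conj_mem_hermSquares h (star_mem hzS))) (inv_nonneg.2 hr.le)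
  convert key using 1
  have hr' : (r : ℂ) ≠ 0 := by exact_mod_cast hr.ne'
  simp only [star_sub, star_smul, star_mul, star_star, star_one, mul_sub, sub_mul,
    smul_mul_assoc, mul_smul_comm, mul_one, one_mul, mul_assoc, RCLike.star_def,
    Complex.conj_ofReal]
  push_cast
  match_scalars <;> field_simp <;> ring

lemma exists_sub_add_mem {h : B} (hb : IsAlgBounded S h) (hs : Star.star h = h) :
    ∃ r : ℝ, 0 < r ∧ (r : ℂ) • (1 : B) + h ∈ hermSquares S ∧
      (r : ℂ) • (1 : B) - h ∈ hermSquares S := by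
  obtain ⟨hS, r, hr, H⟩ := hb
  refine ⟨(r + 1) / 2, by positivity, ?_, ?_⟩
  · convert smul_mem_hermSquares (add_mem H (star_mul_self_mem_hermSquares
      (add_mem (one_mem S) hS))) (r := 1 / 2) (by norm_num) using 1
    simp only [star_add, star_one, hs, mul_add, add_mul, one_mul, mul_one]
    push_cast
    module
  · convert smul_mem_hermSquares (add_mem H (star_mul_self_mem_hermSquares
      (sub_mem (one_mem S) hS))) (r := 1 / 2) (by norm_num) using 1
    simp only [star_sub, star_one, hs, mul_sub, sub_mul, one_mul, mul_one]
    push_cast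
    module

lemma exists_re_im {z : B} (hz : IsAlgBounded S z) : ∃ r : ℝ, 0 < r ∧
    (r : ℂ) • (1 : B) + (2⁻¹ : ℂ) • (z + Star.star z) ∈ hermSquares S ∧
    (r : ℂ) • (1 : B) - (2⁻¹ : ℂ) • (z + Star.star z) ∈ hermSquares S ∧
    (r : ℂ) • (1 : B) + (Complex.I / 2) • (Star.star z - z) ∈ hermSquares S ∧
    (r : ℂ) • (1 : B) - (Complex.I / 2) • (Star.star z - z) ∈ hermSquares S := by
  have hre := (hz.add hz.star).smul 2⁻¹
  have him := (hz.star.add (hz.smul (-1))).smul (Complex.I / 2)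
  rw [neg_one_smul, ← sub_eq_add_neg] at him
  obtain ⟨r, hr, h₁, h₂⟩ := hre.exists_sub_add_mem (by
    simp [star_smul, add_comm])
  obtain ⟨s, hs, h₃, h₄⟩ := him.exists_sub_add_mem (by
    simp only [star_smul, star_sub, star_star, RCLike.star_def, map_div₀, Complex.conj_I, map_ofNat]
    module)
  have hr' := smul_one_mem_hermSquares (S := S) hr.le
  have hs' := smul_one_mem_hermSquares (S := S) hs.le
  refine ⟨r + s, by positivity, ?_, ?_, ?_, ?_⟩
  · convert add_mem h₁ hs' using 1; push_cast; module
  · convert add_mem h₂ hs' using 1; push_cast; module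
  · convert add_mem h₃ hr' using 1; push_cast; module
  · convert add_mem h₄ hr' using 1; push_cast; module

lemma of_sum {ι : Type*} [Fintype ι] {f : ι → B} (hf : ∀ i, f i ∈ S) {r : ℝ} (hr : 0 < r)
    (h : (r : ℂ) • (1 : B) - ∑ i, Star.star (f i) * f i ∈ hermSquares S) (i : ι) :
    IsAlgBounded S (f i) := by
  classical
  refine ⟨hf i, r, hr, ?_⟩
  have h' : ∑ j ∈ Finset.univ.erase i, Star.star (f j) * f j ∈ hermSquares S :=
    sum_mem fun j _ ↦ star_mul_self_mem_hermSquares (hf j)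
  convert add_mem h h' using 1
  rw [← Finset.add_sum_erase _ _ (Finset.mem_univ i)]
  abel

end IsAlgBounded

end BoundedElements

section Commutators

variable {B : Type*} [Ring B] [Algebra ℂ B] {V : Submodule ℂ B}

lemma commutator_mem_mul {v : B} (hV : ∀ w ∈ V, v * w - w * v ∈ V) {a : B} (ha : a ∈ V * V) :
    v * a - a * v ∈ V * V := by
  induction ha using Submodule.mul_induction_on' with
  | mem_mul_mem m hm n hn =>
    have := add_mem (Submodule.mul_mem_mul (hV m hm) hn) (Submodule.mul_mem_mul hm (hV n hn))
    convert this using 1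
    noncomm_ring
  | add a _ b _ iha ihb =>
    convert add_mem iha ihb using 1
    noncomm_ring

/-- If `V` is closed under commutators and `A = -∑ e l ^ 2` with `e l ∈ V`, then
`-∑ e l * A * e l` agrees with `A ^ 2` up to an element of `V * V`. -/
lemma sum_conj_sub_sq_mem {ι : Type*} [Fintype ι] (e : ι → B) (he : ∀ l, e l ∈ V)
    (hV : ∀ v ∈ V, ∀ w ∈ V, v * w - w * v ∈ V) {A : B} (hA : A = -∑ l, e l * e l) :
    -∑ l, e l * A * e l - A * A ∈ V * V := by
  have hAV : A ∈ V * V := by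
    rw [hA]
    exact neg_mem (sum_mem fun l _ ↦ Submodule.mul_mem_mul (he l) (he l))
  have key : ∑ l, (e l * (e l * A - A * e l) - (e l * A - A * e l) * e l) ∈ V * V :=
    sum_mem fun l _ ↦ commutator_mem_mul (hV _ (he l)) (commutator_mem_mul (hV _ (he l)) hAV)
  have hsum : ∑ l, (e l * (e l * A - A * e l) - (e l * A - A * e l) * e l) =
      (2 : ℂ) • (-∑ l, e l * A * e l - A * A) := by
    have h₁ : ∑ l, (e l * (e l * A - A * e l) - (e l * A - A * e l) * e l) =
        (∑ l, e l * e l) * A + A * (∑ l, e l * e l) - (2 : ℂ) • ∑ l, e l * A * e l := by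
      rw [Finset.sum_mul, Finset.mul_sum, Finset.smul_sum, ← Finset.sum_add_distrib,
        ← Finset.sum_sub_distrib]
      refine Finset.sum_congr rfl fun l _ ↦ ?_
      simp only [mul_sub, sub_mul, mul_assoc]
      module
    have h₂ : ∑ l, e l * e l = -A := by rw [hA, neg_neg]
    rw [h₁, h₂, neg_mul, mul_neg]
    module
  rw [hsum] at key
  simpa using (V * V).smul_mem (2⁻¹ : ℂ) key

end Commutators

section Generators

variable {B : Type*} [Ring B] [Algebra ℂ B] {d : ℕ} {X : Fin d → B} {Y : B}

lemma mul_mul_mem_scriptX (k l : Fin (d + 1)) : extX X k * extX X l * Y ∈ scriptX X Y :=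
  Algebra.subset_adjoin ⟨k, l, Or.inl rfl⟩

lemma extX_mul_mem_scriptX (k : Fin (d + 1)) : extX X k * Y ∈ scriptX X Y := by
  have h := (scriptX X Y).smul_mem (mul_mul_mem_scriptX (X := X) (Y := Y) 0 k) (-Complex.I)
  simpa [extX, smul_smul] using h

lemma mem_scriptX : Y ∈ scriptX X Y := by
  have h := (scriptX X Y).smul_mem (extX_mul_mem_scriptX (X := X) (Y := Y) 0) (-Complex.I)
  simpa [extX, smul_smul] using h

lemma commutator_mem_span_extX {c : Fin d → Fin d → Fin d → ℝ}
    (hXlie : ∀ i j, X i * X j - X j * X i = ∑ k : Fin d, (c k i j : ℂ) • X k) {v w : B}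
    (hv : v ∈ Submodule.span ℂ (Set.range (extX X)))
    (hw : w ∈ Submodule.span ℂ (Set.range (extX X))) :
    v * w - w * v ∈ Submodule.span ℂ (Set.range (extX X)) := by
  induction hv using Submodule.span_induction with
  | mem v hv =>
    obtain ⟨i, rfl⟩ := hv
    induction hw using Submodule.span_induction with
    | mem w hw =>
      obtain ⟨j, rfl⟩ := hw
      cases i using Fin.cases with
      | zero => simp [extX]
      | succ i =>
        cases j using Fin.cases with
        | zero => simp [extX]
        | succ j =>
          simp only [extX, Fin.cases_succ, hXlie]
          exact sum_mem fun k _ ↦ Submodule.smul_mem _ _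
            (Submodule.subset_span ⟨k.succ, by simp [extX]⟩)
    | zero => simp
    | add a b _ _ iha ihb =>
      convert add_mem iha ihb using 1
      noncomm_ring
    | smul r a _ iha =>
      convert Submodule.smul_mem _ r iha using 1
      simp [smul_sub]
  | zero => simp
  | add a b _ _ iha ihb =>
    convert add_mem iha ihb using 1
    noncomm_ring
  | smul r a _ iha =>
    convert Submodule.smul_mem _ r iha using 1
    simp [smul_sub]

variable [StarRing B] [StarModule ℂ B]

lemma star_extX (hXstar : ∀ k, star (X k) = - X k) (k : Fin (d + 1)) :
    star (extX X k) = -extX X k := by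
  cases k using Fin.cases with
  | zero => simp [extX, star_smul]
  | succ k => simp [extX, hXstar]

lemma star_mem_scriptX (hXstar : ∀ k, star (X k) = - X k) (hY : star Y = Y) {z : B}
    (hz : z ∈ scriptX X Y) : star z ∈ scriptX X Y := by
  induction hz using Algebra.adjoin_induction with
  | mem z h =>
    obtain ⟨k, l, rfl | rfl⟩ := h <;> apply Algebra.subset_adjoin
    · exact ⟨k, l, Or.inr (by simp [star_extX hXstar, hY])⟩
    · exact ⟨k, l, Or.inl (by simp [star_extX hXstar, hY])⟩
  | algebraMap r =>
    rw [← algebraMap_star_comm]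
    exact Subalgebra.algebraMap_mem _ _
  | add _ _ _ _ h h' => simpa using add_mem h h'
  | mul _ _ _ _ h h' => simpa using mul_mem h' h

/-- `𝒳` as a *-subalgebra. -/
noncomputable def starScriptX (hXstar : ∀ k, star (X k) = - X k) (hY : star Y = Y) :
    StarSubalgebra ℂ B :=
  { scriptX X Y with star_mem' := star_mem_scriptX hXstar hY }

end Generators

/-- The *-algebra `𝒳` is algebraically bounded: for every `z ∈ 𝒳`
there is `λ > 0` with `λ·1 ± Re z ∈ Σ²(𝒳)` and `λ·1 ± Im z ∈ Σ²(𝒳)`, where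
`Re z = (z + z*)/2` and `Im z = (i/2)(z* − z)`. -/
theorem statement9 {B : Type*} [Ring B] [Algebra ℂ B] [StarRing B] [StarModule ℂ B]
    (d : ℕ) (hd : 1 ≤ d)
    (c : Fin d → Fin d → Fin d → ℝ)
    (hc : ∀ k i j, c k i j = - c k j i)
    (X : Fin d → B)
    (hXstar : ∀ k, star (X k) = - X k)
    (hXlie : ∀ i j, X i * X j - X j * X i = ∑ k : Fin d, (c k i j : ℂ) • X k)
    (A Y : B) (hA : A = 1 - ∑ k : Fin d, X k ^ 2)
    (hAY : A * Y = 1) (hYA : Y * A = 1) :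
    ∀ z ∈ scriptX X Y, ∃ lam : ℝ, 0 < lam ∧
      (lam : ℂ) • (1 : B) + (2⁻¹ : ℂ) • (z + star z) ∈ sumSqScriptX X Y ∧
      (lam : ℂ) • (1 : B) - (2⁻¹ : ℂ) • (z + star z) ∈ sumSqScriptX X Y ∧
      (lam : ℂ) • (1 : B) + (Complex.I / 2) • (star z - z) ∈ sumSqScriptX X Y ∧
      (lam : ℂ) • (1 : B) - (Complex.I / 2) • (star z - z) ∈ sumSqScriptX X Y := by
  have he := star_extX hXstar
  set e := extX X with he_def
  have hAe : A = -∑ l, e l * e l := by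
    rw [hA, Fin.sum_univ_succ]
    simp [he_def, extX, smul_smul, pow_two, sub_eq_neg_add]
  have hAs : star A = A := by simp [hAe, star_sum, he]
  have hY : star Y = Y := by
    have h : star Y * A = 1 := by rw [← hAs, ← star_mul, hAY, star_one]
    exact left_inv_eq_right_inv h hAY
  let S : StarSubalgebra ℂ B := starScriptX hXstar hY
  have hYS : Y ∈ S := mem_scriptX
  have heYS (k) : e k * Y ∈ S := extX_mul_mem_scriptX k
  have hsumY : ∑ k, star (e k * Y) * (e k * Y) = Y := by
    calc _ = Y * A * Y := by
          rw [hAe, mul_neg, neg_mul, Finset.mul_sum, Finset.sum_mul, ← Finset.sum_neg_distrib]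
          simp [he, hY, mul_assoc]
      _ = Y := by rw [hYA, one_mul]
  have hY_sub : Y - Y * Y ∈ hermSquares S := by
    have h : ∑ k : Fin d, star (e k.succ * Y) * (e k.succ * Y) ∈ hermSquares S :=
      sum_mem fun k _ ↦ star_mul_self_mem_hermSquares (heYS _)
    convert h using 1
    nth_rewrite 1 [← hsumY]
    rw [Fin.sum_univ_succ]
    simp [he_def, extX, hY, smul_smul, star_smul]
  have hone_sub : ((1 : ℝ) : ℂ) • (1 : B) - Y ∈ hermSquares S := by
    convert add_mem (star_mul_self_mem_hermSquares (sub_mem (one_mem S) hYS)) hY_sub using 1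
    simp only [star_sub, star_one, hY, Complex.ofReal_one, one_smul]
    noncomm_ring
  have heY (k) : IsAlgBounded S (e k * Y) :=
    .of_sum heYS one_pos (by rwa [hsumY]) k
  have hYb : IsAlgBounded S Y := by
    simpa [he_def, extX, smul_smul] using (heY 0).smul (-Complex.I)
  have hYe (k) : IsAlgBounded S (Y * e k) := by
    simpa [he, hY] using (heY k).star.smul (-1)
  set V := Submodule.span ℂ (Set.range e)
  have hVY {v} (hv : v ∈ V) : IsAlgBounded S (v * Y) := by
    induction hv using Submodule.span_induction with
    | mem v h => obtain ⟨k, rfl⟩ := h; exact heY k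
    | zero => simpa using hYb.smul 0
    | add a b _ _ iha ihb => simpa [add_mul] using iha.add ihb
    | smul r a _ iha => simpa using iha.smul r
  have hYV {v} (hv : v ∈ V) : IsAlgBounded S (Y * v) := by
    induction hv using Submodule.span_induction with
    | mem v h => obtain ⟨k, rfl⟩ := h; exact hYe k
    | zero => simpa using hYb.smul 0
    | add a b _ _ iha ihb => simpa [mul_add] using iha.add ihb
    | smul r a _ iha => simpa using iha.smul r
  have hYVVY {t} (ht : t ∈ V * V) : IsAlgBounded S (Y * t * Y) := by
    induction ht using Submodule.mul_induction_on' with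
    | mem_mul_mem m hm n hn => simpa [mul_assoc] using (hYV hm).mul (hVY hn)
    | add a _ b _ iha ihb => simpa [mul_add, add_mul] using iha.add ihb
  let f : Fin (d + 1) × Fin (d + 1) → B := fun p ↦ e p.1 * e p.2 * Y
  have hsum : ∑ p, star (f p) * f p = 1 + Y * (-∑ l, e l * A * e l - A * A) * Y := by
    have h₁ : ∑ p, star (f p) * f p = Y * (-∑ l, e l * A * e l) * Y := by
      rw [Fintype.sum_prod_type_right, hAe]
      simp only [f, Finset.mul_sum, Finset.sum_mul, ← Finset.sum_neg_distrib]
      simp [he, hY, mul_assoc]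
    have h₂ : Y * (A * A) * Y = 1 := by
      rw [← mul_assoc, hYA, one_mul, hAY]
    rw [h₁, mul_sub, sub_mul, h₂]
    abel
  have hsumb : IsAlgBounded S (∑ p, star (f p) * f p) := by
    rw [hsum]
    refine .add (by simpa using IsAlgBounded.algebraMap (S := S) 1) (hYVVY ?_)
    exact sum_conj_sub_sq_mem (V := V) e (fun l ↦ Submodule.subset_span ⟨l, rfl⟩)
      (fun v hv w hw ↦ commutator_mem_span_extX hXlie hv hw) hAe
  obtain ⟨r, hr, -, hsub⟩ := hsumb.exists_sub_add_mem (by simp [star_sum])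
  have hf (p) : IsAlgBounded S (f p) :=
    .of_sum (fun p ↦ mul_mul_mem_scriptX p.1 p.2) hr hsub p
  intro z hz
  refine IsAlgBounded.exists_re_im (S := S) ?_
  induction hz using Algebra.adjoin_induction with
  | mem z h =>
    obtain ⟨k, l, rfl | rfl⟩ := h
    · exact hf (k, l)
    · have := (hf (k, l)).star
      simpa [f, he, hY] using this
  | algebraMap a => exact .algebraMap a
  | add _ _ _ _ h h' => exact h.add h'
  | mul _ _ _ _ h h' => exact h.mul h'
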